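/- Let ρ be a quantum state on a finite-dimensional complex Hilbert space and let S be a convex and compact set of positive semidefinite operators containing at least one state whose support contains supp(ρ). Then σ₀ minimizes σ ↦ D(ρ‖σ) over S if and only if supp(ρ) ⊆ supp(σ₀) and sup_{τ ∈ S} Tr[τ · Ξ(ρ,σ₀)] = 1, where Ξ(ρ,σ₀) = ∫_{−∞}^{∞} σ₀^{−(1+it)/2} ρ σ₀^{−(1−it)/2} β₀(t) dt and β₀(t) = π/(2(cosh(πt)+1)). -/

import Mathlib

open scoped BigOperators ComplexOrder Classical
open MeasureTheory Filter Set

noncomputable section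

namespace QHT

variable {ι : Type*} [Fintype ι] [DecidableEq ι]

/-- Generalized matrix power `A ^ w` (complex exponent `w`) of a Hermitian matrix,
via functional calculus on the support: the eigenvalue `0` is mapped to `0`. -/
def mpow (A : Matrix ι ι ℂ) (w : ℂ) : Matrix ι ι ℂ :=
  if hA : A.IsHermitian then
    (hA.eigenvectorUnitary : Matrix ι ι ℂ) *
      Matrix.diagonal (fun i => if hA.eigenvalues i = 0 then 0 else (hA.eigenvalues i : ℂ) ^ w) *
      star (hA.eigenvectorUnitary : Matrix ι ι ℂ)
  else 0

/-- Matrix logarithm of a Hermitian matrix, taken on its support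
(`Real.log 0 = 0`, so the kernel is mapped to `0`). -/
def mlog (A : Matrix ι ι ℂ) : Matrix ι ι ℂ :=
  if hA : A.IsHermitian then
    (hA.eigenvectorUnitary : Matrix ι ι ℂ) *
      Matrix.diagonal (fun i => (Real.log (hA.eigenvalues i) : ℂ)) *
      star (hA.eigenvectorUnitary : Matrix ι ι ℂ)
  else 0

/-- The support of a matrix, i.e. its range as a linear map. -/
def msupp (A : Matrix ι ι ℂ) : Submodule ℂ (ι → ℂ) := LinearMap.range A.mulVecLin

/-- A quantum state: a positive semidefinite matrix of trace one. -/
def IsState (A : Matrix ι ι ℂ) : Prop := A.PosSemidef ∧ A.trace = 1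

/-- Real part of the trace. -/
def rtr (A : Matrix ι ι ℂ) : ℝ := A.trace.re

/-- The Umegaki relative entropy `D(ρ‖σ)`, with value `+∞` when `supp ρ ⊄ supp σ`. -/
def relEnt (ρ σ : Matrix ι ι ℂ) : EReal :=
  if msupp ρ ≤ msupp σ then ((rtr (ρ * (mlog ρ - mlog σ)) : ℝ) : EReal) else ⊤

/-- The polar of a set of matrices (intersected with the PSD cone). -/
def polar (S : Set (Matrix ι ι ℂ)) : Set (Matrix ι ι ℂ) :=
  {X | X.PosSemidef ∧ ∀ Y ∈ S, rtr (X * Y) ≤ 1}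

/-- Entrywise Bochner integral of a matrix-valued function over `ℝ`. -/
def mInt (f : ℝ → Matrix ι ι ℂ) : Matrix ι ι ℂ :=
  Matrix.of fun i j => ∫ t : ℝ, f t i j

/-- Entrywise Bochner integral of a matrix-valued function over a set `s ⊆ ℝ`. -/
def mIntOn (f : ℝ → Matrix ι ι ℂ) (s : Set ℝ) : Matrix ι ι ℂ :=
  Matrix.of fun i j => ∫ t in s, f t i j

/-- `sinc` function. -/
def sinc (s : ℝ) : ℝ := if s = 0 then 1 else Real.sin s / s

/-- The probability density `β_θ` from the paper (`β₀` is the `θ → 0` limit). -/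
def betaDist (θ t : ℝ) : ℝ :=
  if θ = 0 then Real.pi / (2 * (Real.cosh (Real.pi * t) + 1))
  else Real.sin (θ * Real.pi) / (2 * θ * (Real.cosh (Real.pi * t) + Real.cos (θ * Real.pi)))

/-- `Q_{α,z}(ρ‖σ) = Tr[(ρ^{α/2z} σ^{(1-α)/z} ρ^{α/2z})^z]`. -/
def Qaz (α z : ℝ) (ρ σ : Matrix ι ι ℂ) : ℝ :=
  rtr (mpow (mpow ρ ((α / (2 * z) : ℝ) : ℂ) * mpow σ (((1 - α) / z : ℝ) : ℂ) *
      mpow ρ ((α / (2 * z) : ℝ) : ℂ)) ((z : ℝ) : ℂ))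

/-- The `α`-`z` Rényi relative entropy. -/
def Daz (α z : ℝ) (ρ σ : Matrix ι ι ℂ) : EReal :=
  if (α < 1 ∧ (ρ * σ).trace ≠ 0) ∨ msupp ρ ≤ msupp σ then
    (((α - 1)⁻¹ * Real.log (Qaz α z ρ σ) : ℝ) : EReal)
  else ⊤

/-- `Q_α(ρ‖σ) = Tr[ρ^α σ^{1-α}]` (Petz). -/
def Qpetz (α : ℝ) (ρ σ : Matrix ι ι ℂ) : ℝ :=
  rtr (mpow ρ ((α : ℝ) : ℂ) * mpow σ (((1 - α) : ℝ) : ℂ))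

/-- The Petz Rényi divergence. -/
def Dpetz (α : ℝ) (ρ σ : Matrix ι ι ℂ) : EReal :=
  if (α < 1 ∧ (ρ * σ).trace ≠ 0) ∨ msupp ρ ≤ msupp σ then
    (((α - 1)⁻¹ * Real.log (Qpetz α ρ σ) : ℝ) : EReal)
  else ⊤

/-- `Q̃_α(ρ‖σ) = Tr[(σ^{(1-α)/2α} ρ σ^{(1-α)/2α})^α]` (sandwiched). -/
def Qsand (α : ℝ) (ρ σ : Matrix ι ι ℂ) : ℝ :=
  rtr (mpow (mpow σ (((1 - α) / (2 * α) : ℝ) : ℂ) * ρ * mpow σ (((1 - α) / (2 * α) : ℝ) : ℂ))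
    ((α : ℝ) : ℂ))

/-- The sandwiched Rényi divergence. -/
def Dsand (α : ℝ) (ρ σ : Matrix ι ι ℂ) : EReal :=
  if (α < 1 ∧ (ρ * σ).trace ≠ 0) ∨ msupp ρ ≤ msupp σ then
    (((α - 1)⁻¹ * Real.log (Qsand α ρ σ) : ℝ) : EReal)
  else ⊤

/-- `D̃_∞(ρ‖σ)`: the limit of `D̃_α(ρ‖σ)` as `α → +∞` (encoded as a `limsup`; the limit
exists by monotonicity in `α`). -/
def DsandInf (ρ σ : Matrix ι ι ℂ) : EReal :=
  Filter.limsup (fun α : ℝ => Dsand α ρ σ) Filter.atTop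

/-- `χ_{α,z}(ρ,σ) = ρ^{α/2z} (ρ^{α/2z} σ^{(1-α)/z} ρ^{α/2z})^{z-1} ρ^{α/2z}`. -/
def chi (α z : ℝ) (ρ σ : Matrix ι ι ℂ) : Matrix ι ι ℂ :=
  mpow ρ ((α / (2 * z) : ℝ) : ℂ) *
    mpow (mpow ρ ((α / (2 * z) : ℝ) : ℂ) * mpow σ (((1 - α) / z : ℝ) : ℂ) *
      mpow ρ ((α / (2 * z) : ℝ) : ℂ)) (((z - 1 : ℝ)) : ℂ) *
    mpow ρ ((α / (2 * z) : ℝ) : ℂ)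

/-- The data-processing region `𝒟` for `α`-`z` Rényi relative entropies. -/
def Dregion : Set (ℝ × ℝ) :=
  {p | (0 < p.1 ∧ p.1 < 1 ∧ max p.1 (1 - p.1) ≤ p.2) ∨
       (1 < p.1 ∧ max (p.1 / 2) (p.1 - 1) ≤ p.2 ∧ p.2 ≤ p.1) ∨
       (p.1 = 1 ∧ 0 < p.2)}

end QHT

namespace QHT

variable {ι : Type*} [Fintype ι] [DecidableEq ι]

/-! ### Tensor products and many copies -/

/-- Tensor product of a `d₁`- and a `d₂`-dimensional operator, as a `d₁d₂`-dimensional one. -/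
def dtens {a b : ℕ} (A : Matrix (Fin a) (Fin a) ℂ) (B : Matrix (Fin b) (Fin b) ℂ) :
    Matrix (Fin (a * b)) (Fin (a * b)) ℂ :=
  Matrix.of fun x y =>
    A (finProdFinEquiv.symm x).1 (finProdFinEquiv.symm y).1 *
      B (finProdFinEquiv.symm x).2 (finProdFinEquiv.symm y).2

/-- `ρ^{⊗n}` of a `d`-dimensional operator, as a `d^n`-dimensional operator. -/
def dpow {d : ℕ} (ρ : Matrix (Fin d) (Fin d) ℂ) (n : ℕ) :
    Matrix (Fin (d ^ n)) (Fin (d ^ n)) ℂ :=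
  Matrix.of fun x y => ∏ i, ρ (finFunctionFinEquiv.symm x i) (finFunctionFinEquiv.symm y i)

/-- The action of a permutation of the `k` tensor factors on an operator on `(ℂ^d)^{⊗k}`. -/
def permMat (d k : ℕ) (π : Equiv.Perm (Fin k)) (A : Matrix (Fin (d ^ k)) (Fin (d ^ k)) ℂ) :
    Matrix (Fin (d ^ k)) (Fin (d ^ k)) ℂ :=
  Matrix.of fun x y =>
    A (finFunctionFinEquiv ((finFunctionFinEquiv.symm x) ∘ π))
      (finFunctionFinEquiv ((finFunctionFinEquiv.symm y) ∘ π))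

/-- `ρ^{⊗n}` of a `d`-dimensional operator, as an operator on `H^{⊗n}` with `H = ℂ^d`,
indexed by tuples. -/
def tpow {d : ℕ} (ρ : Matrix (Fin d) (Fin d) ℂ) (n : ℕ) :
    Matrix (Fin n → Fin d) (Fin n → Fin d) ℂ :=
  Matrix.of fun x y => ∏ i, ρ (x i) (y i)

/-- Tensor product of an operator on `H^{⊗m}` and an operator on `H^{⊗n}`, as an
operator on `H^{⊗(m+n)}`. -/
def tensOp {d m n : ℕ} (A : Matrix (Fin m → Fin d) (Fin m → Fin d) ℂ)
    (B : Matrix (Fin n → Fin d) (Fin n → Fin d) ℂ) :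
    Matrix (Fin (m + n) → Fin d) (Fin (m + n) → Fin d) ℂ :=
  Matrix.of fun x y =>
    A (fun i => x (Fin.castAdd n i)) (fun i => y (Fin.castAdd n i)) *
      B (fun j => x (Fin.natAdd m j)) (fun j => y (Fin.natAdd m j))

/-- Permutation action on operators on `H^{⊗k}`. -/
def permOp {d k : ℕ} (π : Equiv.Perm (Fin k))
    (A : Matrix (Fin k → Fin d) (Fin k → Fin d) ℂ) :
    Matrix (Fin k → Fin d) (Fin k → Fin d) ℂ :=
  Matrix.of fun x y => A (x ∘ π) (y ∘ π)

/-! ### Hypothesis testing -/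

/-- A test: an operator `T` with `0 ≤ T ≤ I`. -/
def IsTest (T : Matrix ι ι ℂ) : Prop := T.PosSemidef ∧ (1 - T).PosSemidef

/-- Type I error `α_n(ρ|T) = Tr[(I - T) ρ^{⊗n}]`. -/
def typeI {d : ℕ} (ρ : Matrix (Fin d) (Fin d) ℂ) (n : ℕ)
    (T : Matrix (Fin n → Fin d) (Fin n → Fin d) ℂ) : ℝ :=
  rtr ((1 - T) * tpow ρ n)

/-- Type II error `β_n(S|T) = sup_{σ ∈ S} Tr[σ T]`. -/
def typeII {d n : ℕ} (S : Set (Matrix (Fin n → Fin d) (Fin n → Fin d) ℂ))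
    (T : Matrix (Fin n → Fin d) (Fin n → Fin d) ℂ) : ℝ :=
  sSup ((fun σ => rtr (σ * T)) '' S)

/-- `- log x`, valued in `EReal`, with `- log x = +∞` for `x ≤ 0`. -/
def negLog (x : ℝ) : EReal := if x ≤ 0 then ⊤ else ((- Real.log x : ℝ) : EReal)

/-- The exponential rate `-(1/n) log x`. -/
def rate (n : ℕ) (x : ℝ) : EReal := (((n : ℝ)⁻¹ : ℝ) : EReal) * negLog x

/-- The Stein exponent `s(ρ‖{S_n})`. -/
def steinExp {d : ℕ} (ρ : Matrix (Fin d) (Fin d) ℂ)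
    (S : (n : ℕ) → Set (Matrix (Fin n → Fin d) (Fin n → Fin d) ℂ)) : EReal :=
  sSup ((fun r : ℝ => (r : EReal)) ''
    {r : ℝ | 0 ≤ r ∧ ∃ T : (n : ℕ) → Matrix (Fin n → Fin d) (Fin n → Fin d) ℂ,
      (∀ n, IsTest (T n)) ∧
      (r : EReal) ≤ Filter.liminf (fun n => rate n (typeII (S n) (T n))) Filter.atTop ∧
      Filter.Tendsto (fun n => typeI ρ n (T n)) Filter.atTop (nhds 0)})

/-- The Chernoff exponent `c(ρ‖{S_n})`. -/
def chernoffExp {d : ℕ} (ρ : Matrix (Fin d) (Fin d) ℂ)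
    (S : (n : ℕ) → Set (Matrix (Fin n → Fin d) (Fin n → Fin d) ℂ)) : EReal :=
  Filter.liminf (fun n =>
    rate n (sInf ((fun T => typeI ρ n T + typeII (S n) T) '' {T | IsTest T}))) Filter.atTop

/-- The Hoeffding (direct) exponent `d_r(ρ‖{S_n})`. -/
def hoeffdingExp {d : ℕ} (r : ℝ) (ρ : Matrix (Fin d) (Fin d) ℂ)
    (S : (n : ℕ) → Set (Matrix (Fin n → Fin d) (Fin n → Fin d) ℂ)) : EReal :=
  ⨆ T : {T : (n : ℕ) → Matrix (Fin n → Fin d) (Fin n → Fin d) ℂ //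
      (∀ n, IsTest (T n)) ∧
      (r : EReal) ≤ Filter.liminf (fun n => rate n (typeII (S n) (T n))) Filter.atTop},
    Filter.liminf (fun n => rate n (typeI ρ n (T.1 n))) Filter.atTop

/-- The strong converse exponent `sc_r(ρ‖{S_n})`. -/
def scExp {d : ℕ} (r : ℝ) (ρ : Matrix (Fin d) (Fin d) ℂ)
    (S : (n : ℕ) → Set (Matrix (Fin n → Fin d) (Fin n → Fin d) ℂ)) : EReal :=
  ⨅ T : {T : (n : ℕ) → Matrix (Fin n → Fin d) (Fin n → Fin d) ℂ //
      (∀ n, IsTest (T n)) ∧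
      (r : EReal) ≤ Filter.liminf (fun n => rate n (typeII (S n) (T n))) Filter.atTop},
    Filter.limsup (fun n => rate n (1 - typeI ρ n (T.1 n))) Filter.atTop

/-- Assumption 1 of the paper for a family `{S_n}_{n ≥ 1}` of sets of operators
on `H^{⊗n}`, `H = ℂ^d`: each `S_n` is a convex compact set of positive semidefinite
operators, closed under tensor products, and with polar sets closed under tensor
products. -/
structure Assumption1 {d : ℕ}
    (S : (n : ℕ) → Set (Matrix (Fin n → Fin d) (Fin n → Fin d) ℂ)) : Prop where
  psd : ∀ n, 1 ≤ n → ∀ X ∈ S n, X.PosSemidef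
  convex : ∀ n, 1 ≤ n → Convex ℝ (S n)
  compact : ∀ n, 1 ≤ n → IsCompact (S n)
  tens : ∀ m n, 1 ≤ m → 1 ≤ n → ∀ A ∈ S m, ∀ B ∈ S n, tensOp A B ∈ S (m + n)
  polarTens : ∀ m n, 1 ≤ m → 1 ≤ n →
    ∀ A ∈ polar (S m), ∀ B ∈ polar (S n), tensOp A B ∈ polar (S (m + n))

/-- Assumption 1′ of the paper for a dimension-indexed family `{S_d}_{d ≥ 1}`. -/
structure Assumption1' (S : (d : ℕ) → Set (Matrix (Fin d) (Fin d) ℂ)) : Prop where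
  psd : ∀ d, 1 ≤ d → ∀ X ∈ S d, X.PosSemidef
  convex : ∀ d, 1 ≤ d → Convex ℝ (S d)
  compact : ∀ d, 1 ≤ d → IsCompact (S d)
  tens : ∀ d₁ d₂, 1 ≤ d₁ → 1 ≤ d₂ → ∀ A ∈ S d₁, ∀ B ∈ S d₂, dtens A B ∈ S (d₁ * d₂)
  polarTens : ∀ d₁ d₂, 1 ≤ d₁ → 1 ≤ d₂ →
    ∀ A ∈ polar (S d₁), ∀ B ∈ polar (S d₂), dtens A B ∈ polar (S (d₁ * d₂))

end QHT

namespace QHT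

/-- The operator `Ξ(ρ,σ) = ∫ σ^{-(1+it)/2} ρ σ^{-(1-it)/2} β₀(t) dt`. -/
noncomputable def XiU {ι : Type*} [Fintype ι] [DecidableEq ι]
    (ρ σ : Matrix ι ι ℂ) : Matrix ι ι ℂ :=
  mInt (fun t : ℝ => betaDist 0 t •
    (mpow σ (-((1 : ℂ) + Complex.I * (t : ℂ)) / 2) * ρ *
      mpow σ (-((1 : ℂ) - Complex.I * (t : ℂ)) / 2)))

/-! ### Scalar integrals -/

theorem integrableOn_inv_add_mul_inv_add {x y : ℝ} (hx : 0 < x) (hy : 0 < y) :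
    IntegrableOn (fun s : ℝ => (x + s)⁻¹ * (y + s)⁻¹) (Ioi 0) := by
  have key : ∀ z : ℝ, 0 < z → IntegrableOn (fun s : ℝ => (z + s)⁻¹ ^ 2) (Ioi 0) := by
    intro z hz
    refine integrableOn_Ioi_deriv_of_nonneg' (g := fun s => -(z + s)⁻¹) (l := -0) ?_ ?_ ?_
    · intro s hs
      have hs' : z + s ≠ 0 := by have : (0 : ℝ) ≤ s := hs; positivity
      refine ((((hasDerivAt_id s).const_add z).inv hs').neg).congr_deriv ?_
      simp [div_eq_mul_inv]
    · intro s _; positivity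
    · exact (tendsto_inv_atTop_zero.comp (tendsto_atTop_add_const_left _ z tendsto_id)).neg
  refine Integrable.mono' ((key x hx).add (key y hy)) ?_ ?_
  · exact (by fun_prop : Measurable fun s : ℝ => (x + s)⁻¹ * (y + s)⁻¹).aestronglyMeasurable
  · refine (ae_restrict_mem measurableSet_Ioi).mono fun s hs => ?_
    have hs : (0 : ℝ) < s := hs
    rw [Real.norm_of_nonneg (by positivity)]
    simp only [Pi.add_apply]
    nlinarith [sq_nonneg ((x + s)⁻¹ - (y + s)⁻¹), sq_nonneg ((x + s)⁻¹ + (y + s)⁻¹)]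

theorem integral_inv_add_sq {x : ℝ} (hx : 0 < x) :
    ∫ s in Ioi (0 : ℝ), (x + s)⁻¹ * (x + s)⁻¹ = x⁻¹ := by
  have h := integral_Ioi_of_hasDerivAt_of_tendsto' (a := 0) (f := fun s => -(x + s)⁻¹)
    (f' := fun s => (x + s)⁻¹ * (x + s)⁻¹) (m := -0) ?_ (integrableOn_inv_add_mul_inv_add hx hx)
    (tendsto_inv_atTop_zero.comp (tendsto_atTop_add_const_left _ x tendsto_id)).neg
  · simpa using h
  · intro s hs
    have hs' : x + s ≠ 0 := by have : (0 : ℝ) ≤ s := hs; positivity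
    refine ((((hasDerivAt_id s).const_add x).inv hs').neg).congr_deriv ?_
    simp [div_eq_mul_inv, sq]

theorem integrableOn_inv_add_sub_inv_add {x y : ℝ} (hx : 0 < x) (hy : 0 < y) :
    IntegrableOn (fun s : ℝ => (x + s)⁻¹ - (y + s)⁻¹) (Ioi 0) := by
  have h : IntegrableOn (fun s : ℝ => (y - x) * ((x + s)⁻¹ * (y + s)⁻¹)) (Ioi 0) :=
    (integrableOn_inv_add_mul_inv_add hx hy).const_mul (y - x)
  refine h.congr_fun ?_ measurableSet_Ioi
  intro s hs
  have hs : (0 : ℝ) < s := hs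
  have h1 : x + s ≠ 0 := by positivity
  have h2 : y + s ≠ 0 := by positivity
  simp only
  field_simp
  ring

theorem integral_inv_add_sub_inv_add {x y : ℝ} (hx : 0 < x) (hy : 0 < y) :
    ∫ s in Ioi (0 : ℝ), ((x + s)⁻¹ - (y + s)⁻¹) = Real.log y - Real.log x := by
  have h := integral_Ioi_of_hasDerivAt_of_tendsto' (a := 0)
    (f := fun s => Real.log (x + s) - Real.log (y + s))
    (f' := fun s => (x + s)⁻¹ - (y + s)⁻¹) (m := 0) ?_ (integrableOn_inv_add_sub_inv_add hx hy) ?_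
  · simpa using h
  · intro s hs
    have hs : (0 : ℝ) ≤ s := hs
    have h1 : x + s ≠ 0 := by positivity
    have h2 : y + s ≠ 0 := by positivity
    refine ((((hasDerivAt_id s).const_add x).log h1).sub
      (((hasDerivAt_id s).const_add y).log h2)).congr_deriv ?_
    simp
  · have h1 : Tendsto (fun s : ℝ => 1 + (x - y) * (y + s)⁻¹) atTop (nhds (1 + (x - y) * 0)) :=
      (((tendsto_inv_atTop_zero.comp
        (tendsto_atTop_add_const_left _ y tendsto_id)).const_mul (x - y)).const_add 1)
    have h2 := h1.log (by simp)
    simp only [mul_zero, add_zero, Real.log_one] at h2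
    refine h2.congr' ?_
    filter_upwards [eventually_gt_atTop (0 : ℝ)] with s hs
    rw [← Real.log_div (by positivity) (by positivity)]
    congr 1
    field_simp
    ring

theorem integral_inv_add_mul_inv_add {x y : ℝ} (hx : 0 < x) (hy : 0 < y) (hxy : x ≠ y) :
    ∫ s in Ioi (0 : ℝ), (x + s)⁻¹ * (y + s)⁻¹ = (Real.log y - Real.log x) / (y - x) := by
  rw [← integral_inv_add_sub_inv_add hx hy, ← integral_div]
  refine setIntegral_congr_fun measurableSet_Ioi ?_
  intro s hs
  have hs : (0 : ℝ) < s := hs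
  have h1 : x + s ≠ 0 := by positivity
  have h2 : y + s ≠ 0 := by positivity
  have h3 : y - x ≠ 0 := sub_ne_zero.2 hxy.symm
  simp only
  field_simp
  ring

theorem betaDist_zero_eq_sigmoid (t : ℝ) :
    betaDist 0 t = Real.pi *
      (Real.sigmoid (Real.pi * t) * (1 - Real.sigmoid (Real.pi * t))) := by
  rw [← Real.sigmoid_neg]
  simp only [betaDist, if_true, Real.sigmoid_def, Real.cosh_eq, neg_neg, Real.exp_neg]
  have := Real.exp_pos (Real.pi * t)
  field_simp
  ring

theorem sigmoid_cpow_mul (r : ℝ) (v : ℂ) :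
    (Real.sigmoid r : ℂ) ^ v * (1 - (Real.sigmoid r : ℂ)) ^ (-v) = Complex.exp (v * r) := by
  have h1 := Real.sigmoid_pos r
  have h2 : 0 < 1 - Real.sigmoid r := sub_pos.2 (Real.sigmoid_lt_one r)
  have h3 : (1 - (Real.sigmoid r : ℂ)) = ((1 - Real.sigmoid r : ℝ) : ℂ) := by push_cast; rfl
  rw [h3, Complex.cpow_def_of_ne_zero (by exact_mod_cast h1.ne'),
    Complex.cpow_def_of_ne_zero (by exact_mod_cast h2.ne'), ← Complex.exp_add,
    ← Complex.ofReal_log h1.le, ← Complex.ofReal_log h2.le]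
  have h4 : Real.log (1 - Real.sigmoid r) = Real.log (Real.sigmoid r) - r := by
    rw [← Real.sigmoid_neg, ← Real.sigmoid_mul_rexp_neg, Real.log_mul h1.ne' (Real.exp_pos _).ne',
      Real.log_exp]
    ring
  rw [h4]
  push_cast
  ring_nf

theorem integrable_and_integral_betaDist_zero_mul_exp (c : ℝ) :
    Integrable (fun t : ℝ => (betaDist 0 t : ℂ) * Complex.exp (Complex.I * (c * t))) ∧
    ∫ t : ℝ, (betaDist 0 t : ℂ) * Complex.exp (Complex.I * (c * t)) =
      Complex.Gamma (1 + Complex.I * (c / Real.pi)) *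
        Complex.Gamma (1 - Complex.I * (c / Real.pi)) := by
  set v : ℂ := Complex.I * (c / Real.pi) with hv
  have hpi : (Real.pi : ℂ) ≠ 0 := by exact_mod_cast Real.pi_ne_zero
  have hre : v.re = 0 := by
    have : v = ((c / Real.pi : ℝ) : ℂ) * Complex.I := by rw [hv]; push_cast; ring
    rw [this, Complex.re_ofReal_mul]; simp
  let g : ℝ → ℂ := fun p => (p : ℂ) ^ (1 + v - 1) * (1 - (p : ℂ)) ^ (1 - v - 1)
  let f : ℝ → ℝ := fun t => Real.sigmoid (Real.pi * t)
  let f' : ℝ → ℝ := fun t => Real.pi * (f t * (1 - f t))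
  have hderiv : ∀ t ∈ (univ : Set ℝ), HasDerivWithinAt f (f' t) univ t := by
    intro t _
    refine HasDerivAt.hasDerivWithinAt ?_
    refine ((Real.hasDerivAt_sigmoid (Real.pi * t)).comp t
      ((hasDerivAt_id t).const_mul Real.pi)).congr_deriv ?_
    simp only [f', f]; ring
  have hinj : InjOn f univ := fun a _ b _ h =>
    mul_left_cancel₀ Real.pi_ne_zero (Real.sigmoid_injective h)
  have himg : f '' univ = Ioo 0 1 := by
    rw [← Real.range_sigmoid, image_univ]
    ext p
    constructor
    · rintro ⟨t, rfl⟩; exact ⟨_, rfl⟩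
    · rintro ⟨t, rfl⟩
      exact ⟨t / Real.pi, by simp only [f]; congr 1; field_simp⟩
  have hfun : (fun t : ℝ => |f' t| • g (f t)) =
      fun t : ℝ => (betaDist 0 t : ℂ) * Complex.exp (Complex.I * (c * t)) := by
    funext t
    have hpos : 0 ≤ f' t := by
      have h1 := Real.sigmoid_pos (Real.pi * t)
      have h2 : 0 < 1 - Real.sigmoid (Real.pi * t) := sub_pos.2 (Real.sigmoid_lt_one _)
      exact mul_nonneg Real.pi_pos.le (mul_nonneg h1.le h2.le)
    rw [abs_of_nonneg hpos, Complex.real_smul, betaDist_zero_eq_sigmoid]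
    have h1 : (1 + v - 1 : ℂ) = v := by ring
    have h2 : (1 - v - 1 : ℂ) = -v := by ring
    simp only [g, f, f', h1, h2]
    rw [sigmoid_cpow_mul]
    congr 2
    rw [hv]; push_cast; field_simp
  have hconv := Complex.betaIntegral_convergent (u := 1 + v) (v := 1 - v)
    (by simp [hre]) (by simp [hre])
  rw [intervalIntegrable_iff_integrableOn_Ioo_of_le zero_le_one] at hconv
  refine ⟨?_, ?_⟩
  · have := (integrableOn_image_iff_integrableOn_abs_deriv_smul MeasurableSet.univ hderiv hinj g).1
      (by rw [himg]; exact hconv)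
    rwa [hfun, integrableOn_univ] at this
  · have := integral_image_eq_integral_abs_deriv_smul MeasurableSet.univ hderiv hinj g
    rw [hfun, Measure.restrict_univ, himg] at this
    rw [← this, Complex.Gamma_mul_Gamma_eq_betaIntegral (by simp [hre]) (by simp [hre]),
      show (1 + v + (1 - v) : ℂ) = 1 + 1 by ring, Complex.Gamma_add_one 1 one_ne_zero,
      Complex.Gamma_one, Complex.betaIntegral, intervalIntegral.integral_of_le zero_le_one,
      integral_Ioc_eq_integral_Ioo]
    simp [g]

theorem integral_betaDist_zero_mul_exp {c : ℝ} (hc : c ≠ 0) :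
    ∫ t : ℝ, (betaDist 0 t : ℂ) * Complex.exp (Complex.I * (c * t)) =
      ((c / Real.sinh c : ℝ) : ℂ) := by
  rw [(integrable_and_integral_betaDist_zero_mul_exp c).2]
  have hpi : (Real.pi : ℂ) ≠ 0 := by exact_mod_cast Real.pi_ne_zero
  have hc' : (c : ℂ) ≠ 0 := by exact_mod_cast hc
  have hv : Complex.I * (c / Real.pi) ≠ 0 := by simp [hc, Real.pi_ne_zero]
  have hs : Complex.sinh c ≠ 0 := by
    rw [← Complex.ofReal_sinh]; exact_mod_cast Real.sinh_ne_zero.2 hc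
  rw [add_comm 1 (Complex.I * _), Complex.Gamma_add_one _ hv, mul_assoc,
    Complex.Gamma_mul_Gamma_one_sub,
    show (Real.pi : ℂ) * (Complex.I * (c / Real.pi)) = c * Complex.I by field_simp,
    Complex.sin_mul_I]
  push_cast
  field_simp

theorem cpow_mul_cpow_eq_exp {x y : ℝ} (hx : 0 < x) (hy : 0 < y) (t : ℝ) :
    (x : ℂ) ^ (-((1 : ℂ) + Complex.I * (t : ℂ)) / 2) *
      (y : ℂ) ^ (-((1 : ℂ) - Complex.I * (t : ℂ)) / 2) =
    (Real.exp (-(Real.log x + Real.log y) / 2) : ℂ) *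
      Complex.exp (Complex.I * ((((Real.log y - Real.log x) / 2 : ℝ) : ℂ) * t)) := by
  rw [Complex.cpow_def_of_ne_zero (by exact_mod_cast hx.ne'),
    Complex.cpow_def_of_ne_zero (by exact_mod_cast hy.ne'), ← Complex.exp_add,
    ← Complex.ofReal_log hx.le, ← Complex.ofReal_log hy.le, Complex.ofReal_exp, ← Complex.exp_add]
  congr 1
  push_cast
  ring

theorem integrable_betaDist_zero_mul_cpow {x y : ℝ} (hx : 0 < x) (hy : 0 < y) :
    Integrable (fun t : ℝ => (betaDist 0 t : ℂ) *
      ((x : ℂ) ^ (-((1 : ℂ) + Complex.I * (t : ℂ)) / 2) *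
        (y : ℂ) ^ (-((1 : ℂ) - Complex.I * (t : ℂ)) / 2))) := by
  simp_rw [cpow_mul_cpow_eq_exp hx hy, mul_left_comm (Complex.ofReal (betaDist 0 _))]
  exact (integrable_and_integral_betaDist_zero_mul_exp _).1.const_mul _

theorem integral_betaDist_zero_mul_cpow {x y : ℝ} (hx : 0 < x) (hy : 0 < y) :
    ∫ t : ℝ, (betaDist 0 t : ℂ) *
      ((x : ℂ) ^ (-((1 : ℂ) + Complex.I * (t : ℂ)) / 2) *
        (y : ℂ) ^ (-((1 : ℂ) - Complex.I * (t : ℂ)) / 2)) =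
    ((∫ s in Ioi (0 : ℝ), (x + s)⁻¹ * (y + s)⁻¹ : ℝ) : ℂ) := by
  simp_rw [cpow_mul_cpow_eq_exp hx hy, mul_left_comm (Complex.ofReal (betaDist 0 _))]
  rw [integral_const_mul]
  rcases eq_or_ne x y with rfl | hxy
  · rw [(integrable_and_integral_betaDist_zero_mul_exp _).2, integral_inv_add_sq hx]
    rw [show -(Real.log x + Real.log x) / 2 = -Real.log x by ring, Real.exp_neg, Real.exp_log hx]
    simp
  · have hl : Real.log x ≠ Real.log y := fun h => hxy (Real.log_injOn_pos hx hy h)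
    have hc : (Real.log y - Real.log x) / 2 ≠ 0 :=
      div_ne_zero (sub_ne_zero.2 hl.symm) two_ne_zero
    rw [integral_betaDist_zero_mul_exp hc, integral_inv_add_mul_inv_add hx hy hxy,
      ← Complex.ofReal_mul]
    congr 1
    have hs : Real.sinh ((Real.log y - Real.log x) / 2) ≠ 0 := Real.sinh_ne_zero.2 hc
    have key : y - x = Real.exp ((Real.log x + Real.log y) / 2) *
        (2 * Real.sinh ((Real.log y - Real.log x) / 2)) := by
      rw [Real.sinh_eq, mul_div_cancel₀ _ (two_ne_zero), mul_sub, ← Real.exp_add, ← Real.exp_add]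
      ring_nf
      rw [Real.exp_log hx, Real.exp_log hy]
    have h0 := (Real.exp_pos ((Real.log x + Real.log y) / 2)).ne'
    rw [key, neg_div, Real.exp_neg]
    field_simp

/-! ### Functional calculus in an eigenbasis -/

section Spectral

variable {ι : Type*} [Fintype ι] [DecidableEq ι]

/-- Functional calculus of a Hermitian matrix in its eigenbasis. -/
def spectralFun {A : Matrix ι ι ℂ} (hA : A.IsHermitian) (f : ℝ → ℂ) : Matrix ι ι ℂ :=
  (hA.eigenvectorUnitary : Matrix ι ι ℂ) * Matrix.diagonal (fun i => f (hA.eigenvalues i)) *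
    star (hA.eigenvectorUnitary : Matrix ι ι ℂ)

/-- The matrix `X` written in the eigenbasis of the Hermitian matrix `A`. -/
def inEigenbasis {A : Matrix ι ι ℂ} (hA : A.IsHermitian) (X : Matrix ι ι ℂ) : Matrix ι ι ℂ :=
  star (hA.eigenvectorUnitary : Matrix ι ι ℂ) * X * (hA.eigenvectorUnitary : Matrix ι ι ℂ)

variable {A : Matrix ι ι ℂ}

theorem star_eigenvectorUnitary_mul_self (hA : A.IsHermitian) :
    star (hA.eigenvectorUnitary : Matrix ι ι ℂ) * (hA.eigenvectorUnitary : Matrix ι ι ℂ) = 1 :=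
  Unitary.coe_star_mul_self _

theorem eigenvectorUnitary_mul_star_self (hA : A.IsHermitian) :
    (hA.eigenvectorUnitary : Matrix ι ι ℂ) * star (hA.eigenvectorUnitary : Matrix ι ι ℂ) = 1 :=
  Unitary.coe_mul_star_self _

theorem spectralFun_ofReal (hA : A.IsHermitian) : spectralFun hA (fun x => (x : ℂ)) = A := by
  conv_rhs => rw [hA.spectral_theorem, Unitary.conjStarAlgAut_apply]
  rfl

theorem spectralFun_mul (hA : A.IsHermitian) (f g : ℝ → ℂ) :
    spectralFun hA f * spectralFun hA g = spectralFun hA (fun x => f x * g x) := by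
  simp only [spectralFun, Matrix.mul_assoc]
  rw [← Matrix.mul_assoc (star _) (hA.eigenvectorUnitary : Matrix ι ι ℂ),
    star_eigenvectorUnitary_mul_self, Matrix.one_mul, ← Matrix.mul_assoc (Matrix.diagonal _),
    Matrix.diagonal_mul_diagonal]

theorem inEigenbasis_mul (hA : A.IsHermitian) (X Y : Matrix ι ι ℂ) :
    inEigenbasis hA (X * Y) = inEigenbasis hA X * inEigenbasis hA Y := by
  simp only [inEigenbasis, Matrix.mul_assoc]
  rw [← Matrix.mul_assoc (hA.eigenvectorUnitary : Matrix ι ι ℂ) (star _),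
    eigenvectorUnitary_mul_star_self, Matrix.one_mul]

theorem inEigenbasis_spectralFun (hA : A.IsHermitian) (f : ℝ → ℂ) :
    inEigenbasis hA (spectralFun hA f) = Matrix.diagonal (fun i => f (hA.eigenvalues i)) := by
  simp only [inEigenbasis, spectralFun, Matrix.mul_assoc]
  rw [star_eigenvectorUnitary_mul_self, Matrix.mul_one, ← Matrix.mul_assoc,
    star_eigenvectorUnitary_mul_self, Matrix.one_mul]

theorem inEigenbasis_self (hA : A.IsHermitian) :
    inEigenbasis hA A = Matrix.diagonal (fun i => (hA.eigenvalues i : ℂ)) :=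
  (congrArg (inEigenbasis hA) (spectralFun_ofReal hA)).symm.trans (inEigenbasis_spectralFun hA _)

theorem trace_inEigenbasis (hA : A.IsHermitian) (X : Matrix ι ι ℂ) :
    (inEigenbasis hA X).trace = X.trace := by
  rw [inEigenbasis, Matrix.trace_mul_comm, ← Matrix.mul_assoc, eigenvectorUnitary_mul_star_self,
    Matrix.one_mul]

theorem inEigenbasis_conjTranspose (hA : A.IsHermitian) (X : Matrix ι ι ℂ) :
    (inEigenbasis hA X).conjTranspose = inEigenbasis hA X.conjTranspose := by
  simp [inEigenbasis, Matrix.star_eq_conjTranspose, Matrix.mul_assoc]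

theorem eq_of_inEigenbasis_eq (hA : A.IsHermitian) {X Y : Matrix ι ι ℂ}
    (h : inEigenbasis hA X = inEigenbasis hA Y) : X = Y := by
  have key : ∀ Z : Matrix ι ι ℂ, (hA.eigenvectorUnitary : Matrix ι ι ℂ) * inEigenbasis hA Z *
      star (hA.eigenvectorUnitary : Matrix ι ι ℂ) = Z := by
    intro Z
    simp only [inEigenbasis, Matrix.mul_assoc]
    rw [eigenvectorUnitary_mul_star_self, Matrix.mul_one, ← Matrix.mul_assoc,
      eigenvectorUnitary_mul_star_self, Matrix.one_mul]
  rw [← key X, ← key Y, h]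

theorem trace_mul_spectralFun (hA : A.IsHermitian) (X : Matrix ι ι ℂ) (f : ℝ → ℂ) :
    (X * spectralFun hA f).trace = ∑ i, inEigenbasis hA X i i * f (hA.eigenvalues i) := by
  rw [← trace_inEigenbasis hA, inEigenbasis_mul, inEigenbasis_spectralFun]
  simp [Matrix.trace, Matrix.mul_diagonal]

theorem trace_mul_spectralFun_mul_spectralFun (hA : A.IsHermitian) (X Y : Matrix ι ι ℂ)
    (f g : ℝ → ℂ) :
    (X * (spectralFun hA f * Y * spectralFun hA g)).trace =
      ∑ i, ∑ j, inEigenbasis hA X i j * inEigenbasis hA Y j i *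
        (f (hA.eigenvalues j) * g (hA.eigenvalues i)) := by
  rw [← trace_inEigenbasis hA]
  simp only [inEigenbasis_mul, inEigenbasis_spectralFun]
  simp only [Matrix.trace, Matrix.diag, Matrix.mul_apply (M := inEigenbasis hA X),
    Matrix.mul_diagonal, Matrix.diagonal_mul]
  refine Finset.sum_congr rfl fun i _ => Finset.sum_congr rfl fun j _ => ?_
  ring

theorem mpow_eq_spectralFun (hA : A.IsHermitian) (w : ℂ) :
    mpow A w = spectralFun hA (fun x => if x = 0 then 0 else (x : ℂ) ^ w) := by
  rw [mpow, dif_pos hA]; rfl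

theorem mlog_eq_spectralFun (hA : A.IsHermitian) :
    mlog A = spectralFun hA (fun x => (Real.log x : ℂ)) := by
  rw [mlog, dif_pos hA]; rfl

theorem spectralFun_const_one (hA : A.IsHermitian) : spectralFun hA (fun _ => 1) = 1 := by
  simp [spectralFun]

theorem add_smul_one_eq_spectralFun (hA : A.IsHermitian) (s : ℝ) :
    A + (s : ℂ) • (1 : Matrix ι ι ℂ) = spectralFun hA (fun x => ((x + s : ℝ) : ℂ)) := by
  conv_lhs => rw [← spectralFun_ofReal hA, ← spectralFun_const_one hA]
  refine eq_of_inEigenbasis_eq hA ?_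
  rw [inEigenbasis_spectralFun, inEigenbasis, Matrix.mul_add, Matrix.add_mul, Matrix.mul_smul,
    Matrix.smul_mul]
  change inEigenbasis hA _ + (s : ℂ) • inEigenbasis hA _ = _
  rw [inEigenbasis_spectralFun, inEigenbasis_spectralFun, ← Matrix.diagonal_smul,
    Matrix.diagonal_add]
  congr 1
  funext i
  simp

theorem inv_add_smul_one_eq_spectralFun (hA : A.PosSemidef) {s : ℝ} (hs : 0 < s) :
    (A + (s : ℂ) • (1 : Matrix ι ι ℂ))⁻¹ =
      spectralFun hA.1 (fun x => (((x + s)⁻¹ : ℝ) : ℂ)) := by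
  refine Matrix.inv_eq_right_inv ?_
  rw [add_smul_one_eq_spectralFun hA.1, spectralFun_mul]
  refine eq_of_inEigenbasis_eq hA.1 ?_
  rw [← spectralFun_const_one hA.1, inEigenbasis_spectralFun, inEigenbasis_spectralFun]
  congr 1
  funext i
  have h : hA.1.eigenvalues i + s ≠ 0 := (add_pos_of_nonneg_of_pos (hA.eigenvalues_nonneg i) hs).ne'
  rw [← Complex.ofReal_mul, mul_inv_cancel₀ h, Complex.ofReal_one]

/-! ### Supports -/

theorem msupp_le_iff_exists_mul {B C : Matrix ι ι ℂ} :
    msupp B ≤ msupp C ↔ ∃ M : Matrix ι ι ℂ, B = C * M := by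
  constructor
  · intro h
    have h1 : ∀ j, ∃ v : ι → ℂ, C.mulVec v = B.mulVec (Pi.single j 1) := fun j => by
      obtain ⟨v, hv⟩ := h ⟨Pi.single j 1, rfl⟩
      exact ⟨v, by simpa using hv⟩
    choose v hv using h1
    refine ⟨Matrix.of fun i j => v j i, ?_⟩
    ext i j
    have := congrFun (hv j) i
    rw [Matrix.mulVec_single_one] at this
    simpa [Matrix.mul_apply, Matrix.mulVec, dotProduct] using this.symm
  · rintro ⟨M, rfl⟩ _ ⟨v, rfl⟩
    exact ⟨M.mulVec v, by simp [Matrix.mulVec_mulVec]⟩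

theorem inEigenbasis_apply_eq_zero_left (hA : A.IsHermitian) {B : Matrix ι ι ℂ}
    (h : msupp B ≤ msupp A) {i : ι} (hi : hA.eigenvalues i = 0) (j : ι) :
    inEigenbasis hA B i j = 0 := by
  obtain ⟨M, rfl⟩ := msupp_le_iff_exists_mul.1 h
  rw [inEigenbasis_mul, inEigenbasis_self, Matrix.diagonal_mul, hi]
  simp

theorem inEigenbasis_apply_eq_zero_right (hA : A.IsHermitian) {B : Matrix ι ι ℂ}
    (hB : B.IsHermitian) (h : msupp B ≤ msupp A) {i : ι} (hi : hA.eigenvalues i = 0) (j : ι) :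
    inEigenbasis hA B j i = 0 := by
  have h1 := inEigenbasis_conjTranspose hA B
  rw [hB.eq] at h1
  rw [← h1, Matrix.conjTranspose_apply, inEigenbasis_apply_eq_zero_left hA h hi, star_zero]

theorem inEigenbasis_posSemidef (hA : A.IsHermitian) {B : Matrix ι ι ℂ} (hB : B.PosSemidef) :
    (inEigenbasis hA B).PosSemidef := by
  rw [inEigenbasis, Matrix.star_eq_conjTranspose]
  exact hB.conjTranspose_mul_mul_same _

theorem msupp_le_of_mulVec_eq_zero {B C : Matrix ι ι ℂ} (hB : B.IsHermitian) (hC : C.IsHermitian)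
    (h : ∀ v, C.mulVec v = 0 → B.mulVec v = 0) : msupp B ≤ msupp C := by
  have hcol : ∀ i j, hC.eigenvalues j = 0 → inEigenbasis hC B i j = 0 := by
    intro i j hj
    have h1 : C.mulVec (⇑(hC.eigenvectorBasis j)) = 0 := by
      rw [hC.mulVec_eigenvectorBasis, hj, zero_smul]
    have h2 := h _ h1
    rw [← hC.eigenvectorUnitary_mulVec, Matrix.mulVec_mulVec] at h2
    have h3 : (inEigenbasis hC B).mulVec (Pi.single j 1) = 0 := by
      rw [inEigenbasis, Matrix.mul_assoc, ← Matrix.mulVec_mulVec, h2, Matrix.mulVec_zero]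
    rw [Matrix.mulVec_single_one] at h3
    exact congrFun h3 i
  refine msupp_le_iff_exists_mul.2 ⟨spectralFun hC (fun x => ((x⁻¹ : ℝ) : ℂ)) * B, ?_⟩
  refine eq_of_inEigenbasis_eq hC ?_
  rw [← Matrix.mul_assoc, inEigenbasis_mul, inEigenbasis_mul, inEigenbasis_self,
    inEigenbasis_spectralFun, Matrix.diagonal_mul_diagonal]
  ext i j
  rw [Matrix.diagonal_mul]
  by_cases hi : hC.eigenvalues i = 0
  · have h1 := inEigenbasis_conjTranspose hC B
    rw [hB.eq] at h1
    rw [← h1, Matrix.conjTranspose_apply, hcol j i hi]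
    simp
  · rw [← Complex.ofReal_mul, mul_inv_cancel₀ hi, Complex.ofReal_one, one_mul]

theorem msupp_le_msupp_add {B C : Matrix ι ι ℂ} (hB : B.PosSemidef) (hC : C.PosSemidef) :
    msupp B ≤ msupp (B + C) := by
  refine msupp_le_of_mulVec_eq_zero hB.1 (hB.add hC).1 fun v hv => ?_
  have h0 : dotProduct (star v) (B.mulVec v) + dotProduct (star v) (C.mulVec v) = 0 := by
    rw [← dotProduct_add, ← Matrix.add_mulVec, hv, dotProduct_zero]
  refine (hB.dotProduct_mulVec_zero_iff v).1 ?_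
  have h1 := hB.dotProduct_mulVec_nonneg v
  have h2 := hC.dotProduct_mulVec_nonneg v
  exact ((add_eq_zero_iff_of_nonneg h1 h2).1 h0).1

theorem rtr_mul_nonneg {B C : Matrix ι ι ℂ} (hB : B.PosSemidef) (hC : C.PosSemidef) :
    0 ≤ rtr (B * C) := by
  have h := (inEigenbasis_posSemidef hB.1 hC)
  rw [rtr, Matrix.trace_mul_comm, ← trace_inEigenbasis hB.1, inEigenbasis_mul,
    inEigenbasis_self, Matrix.trace, Complex.re_sum]
  refine Finset.sum_nonneg fun i _ => ?_
  rw [Matrix.diag_apply, Matrix.mul_diagonal, Complex.re_mul_ofReal]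
  exact mul_nonneg (Complex.nonneg_iff.1 h.diag_nonneg).1 (hB.eigenvalues_nonneg i)

end Spectral

/-! ### Integral representations -/

section Representation

variable {ι : Type*} [Fintype ι] [DecidableEq ι]

/-- The resolvent `(A + s)⁻¹`. -/
def resolvent (A : Matrix ι ι ℂ) (s : ℝ) : Matrix ι ι ℂ := (A + (s : ℂ) • (1 : Matrix ι ι ℂ))⁻¹

theorem trace_mul_mInt {κ : Type*} [Fintype κ] (X : Matrix κ κ ℂ) {f : ℝ → Matrix κ κ ℂ}
    (hf : ∀ i j, Integrable fun t => f t i j) :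
    (X * mInt f).trace = ∫ t, (X * f t).trace := by
  have h : ∀ t, (X * f t).trace = ∑ i, ∑ j, X i j * f t j i := fun t => by
    simp [Matrix.trace, Matrix.mul_apply]
  simp_rw [h]
  refine Eq.trans ?_ (integral_finsetSum _ fun i _ => integrable_finsetSum _ fun j _ =>
    (hf j i).const_mul (X i j)).symm
  refine Finset.sum_congr rfl fun i _ => ?_
  refine Eq.trans ?_ (integral_finsetSum _ fun j _ => (hf j i).const_mul (X i j)).symm
  exact Finset.sum_congr rfl fun j _ => (integral_const_mul (X i j) _).symm

variable {ρ σ : Matrix ι ι ℂ}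

theorem trace_mul_XiU (hσ : σ.PosSemidef) (hρ : ρ.IsHermitian) (h : msupp ρ ≤ msupp σ)
    (X : Matrix ι ι ℂ) :
    (X * XiU ρ σ).trace = ∑ i, ∑ j, inEigenbasis hσ.1 X i j * inEigenbasis hσ.1 ρ j i *
      ((∫ s in Ioi (0 : ℝ), (hσ.1.eigenvalues j + s)⁻¹ * (hσ.1.eigenvalues i + s)⁻¹ : ℝ) : ℂ) := by
  let F : ℝ → ℝ → ℂ := fun t x =>
    if x = 0 then 0 else (x : ℂ) ^ (-((1 : ℂ) + Complex.I * (t : ℂ)) / 2)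
  let G : ℝ → ℝ → ℂ := fun t x =>
    if x = 0 then 0 else (x : ℂ) ^ (-((1 : ℂ) - Complex.I * (t : ℂ)) / 2)
  let f : ℝ → Matrix ι ι ℂ := fun t => betaDist 0 t •
    (mpow σ (-((1 : ℂ) + Complex.I * (t : ℂ)) / 2) * ρ *
      mpow σ (-((1 : ℂ) - Complex.I * (t : ℂ)) / 2))
  have hf : ∀ (Y : Matrix ι ι ℂ) (t : ℝ), (Y * f t).trace =
      ∑ i, ∑ j, inEigenbasis hσ.1 Y i j * inEigenbasis hσ.1 ρ j i *
        ((betaDist 0 t : ℂ) * (F t (hσ.1.eigenvalues j) * G t (hσ.1.eigenvalues i))) := by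
    intro Y t
    simp only [f]
    rw [mpow_eq_spectralFun hσ.1, mpow_eq_spectralFun hσ.1, Matrix.mul_smul, Matrix.trace_smul,
      trace_mul_spectralFun_mul_spectralFun, Complex.real_smul, Finset.mul_sum]
    refine Finset.sum_congr rfl fun i _ => ?_
    rw [Finset.mul_sum]
    refine Finset.sum_congr rfl fun j _ => ?_
    simp only [F, G]
    ring
  have hterm : ∀ (Y : Matrix ι ι ℂ) (i j : ι),
      Integrable (fun t : ℝ => inEigenbasis hσ.1 Y i j * inEigenbasis hσ.1 ρ j i *
        ((betaDist 0 t : ℂ) * (F t (hσ.1.eigenvalues j) * G t (hσ.1.eigenvalues i)))) ∧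
      ∫ t : ℝ, inEigenbasis hσ.1 Y i j * inEigenbasis hσ.1 ρ j i *
        ((betaDist 0 t : ℂ) * (F t (hσ.1.eigenvalues j) * G t (hσ.1.eigenvalues i))) =
      inEigenbasis hσ.1 Y i j * inEigenbasis hσ.1 ρ j i *
      ((∫ s in Ioi (0 : ℝ),
        (hσ.1.eigenvalues j + s)⁻¹ * (hσ.1.eigenvalues i + s)⁻¹ : ℝ) : ℂ) := by
    intro Y i j
    by_cases hi : hσ.1.eigenvalues i = 0
    · simp [inEigenbasis_apply_eq_zero_right hσ.1 hρ h hi j]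
    by_cases hj : hσ.1.eigenvalues j = 0
    · simp [inEigenbasis_apply_eq_zero_left hσ.1 h hj i]
    have hi' := lt_of_le_of_ne (hσ.eigenvalues_nonneg i) (Ne.symm hi)
    have hj' := lt_of_le_of_ne (hσ.eigenvalues_nonneg j) (Ne.symm hj)
    simp only [F, G, hi, hj, if_false]
    refine ⟨(integrable_betaDist_zero_mul_cpow hj' hi').const_mul _, ?_⟩
    rw [integral_const_mul, integral_betaDist_zero_mul_cpow hj' hi']
  have hint : ∀ i j, Integrable fun t => f t i j := by
    intro i j
    have h1 : ∀ t, f t i j = (Matrix.single j i 1 * f t).trace := fun t => by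
      simp [Matrix.trace_single_mul]
    simp_rw [h1, hf]
    exact integrable_finsetSum _ fun k _ => integrable_finsetSum _ fun l _ => (hterm _ k l).1
  change (X * mInt f).trace = _
  rw [trace_mul_mInt X hint]
  simp_rw [hf]
  rw [integral_finsetSum _ fun i _ => integrable_finsetSum _ fun j _ => (hterm X i j).1]
  refine Finset.sum_congr rfl fun i _ => ?_
  rw [integral_finsetSum _ fun j _ => (hterm X i j).1]
  exact Finset.sum_congr rfl fun j _ => (hterm X i j).2

theorem integrableOn_and_integral_trace_resolvent (hσ : σ.PosSemidef) (hρ : ρ.IsHermitian)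
    (h : msupp ρ ≤ msupp σ) (X : Matrix ι ι ℂ) :
    IntegrableOn (fun s => (X * (resolvent σ s * ρ * resolvent σ s)).trace) (Ioi 0) ∧
    ∫ s in Ioi (0 : ℝ), (X * (resolvent σ s * ρ * resolvent σ s)).trace =
      (X * XiU ρ σ).trace := by
  have hf : EqOn (fun s => ∑ i, ∑ j, inEigenbasis hσ.1 X i j * inEigenbasis hσ.1 ρ j i *
        (((hσ.1.eigenvalues j + s)⁻¹ * (hσ.1.eigenvalues i + s)⁻¹ : ℝ) : ℂ))
      (fun s => (X * (resolvent σ s * ρ * resolvent σ s)).trace) (Ioi 0) := by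
    intro s hs
    simp only [resolvent]
    rw [inv_add_smul_one_eq_spectralFun hσ hs, trace_mul_spectralFun_mul_spectralFun]
    push_cast
    rfl
  have hterm : ∀ i j : ι,
      IntegrableOn (fun s : ℝ => inEigenbasis hσ.1 X i j * inEigenbasis hσ.1 ρ j i *
        (((hσ.1.eigenvalues j + s)⁻¹ * (hσ.1.eigenvalues i + s)⁻¹ : ℝ) : ℂ)) (Ioi 0) := by
    intro i j
    by_cases hi : hσ.1.eigenvalues i = 0
    · simp [inEigenbasis_apply_eq_zero_right hσ.1 hρ h hi j]
    by_cases hj : hσ.1.eigenvalues j = 0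
    · simp [inEigenbasis_apply_eq_zero_left hσ.1 h hj i]
    have hi' := lt_of_le_of_ne (hσ.eigenvalues_nonneg i) (Ne.symm hi)
    have hj' := lt_of_le_of_ne (hσ.eigenvalues_nonneg j) (Ne.symm hj)
    exact (Integrable.ofReal (integrableOn_inv_add_mul_inv_add hj' hi')).const_mul _
  refine ⟨IntegrableOn.congr_fun (integrable_finsetSum _ fun i _ => integrable_finsetSum _
    fun j _ => hterm i j) hf measurableSet_Ioi, ?_⟩
  rw [← setIntegral_congr_fun measurableSet_Ioi hf, trace_mul_XiU hσ hρ h,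
    integral_finsetSum _ fun i _ => integrable_finsetSum _ fun j _ => hterm i j]
  refine Finset.sum_congr rfl fun i _ => ?_
  rw [integral_finsetSum _ fun j _ => hterm i j]
  refine Finset.sum_congr rfl fun j _ => ?_
  rw [integral_const_mul]
  exact congrArg _ integral_ofReal

theorem integrableOn_rtr_resolvent (hσ : σ.PosSemidef) (hρ : ρ.IsHermitian)
    (h : msupp ρ ≤ msupp σ) (X : Matrix ι ι ℂ) :
    IntegrableOn (fun s => rtr (X * (resolvent σ s * ρ * resolvent σ s))) (Ioi 0) :=
  (integrableOn_and_integral_trace_resolvent hσ hρ h X).1.re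

theorem integral_rtr_resolvent (hσ : σ.PosSemidef) (hρ : ρ.IsHermitian)
    (h : msupp ρ ≤ msupp σ) (X : Matrix ι ι ℂ) :
    ∫ s in Ioi (0 : ℝ), rtr (X * (resolvent σ s * ρ * resolvent σ s)) = rtr (X * XiU ρ σ) := by
  rw [rtr, ← (integrableOn_and_integral_trace_resolvent hσ hρ h X).2]
  exact integral_re (integrableOn_and_integral_trace_resolvent hσ hρ h X).1

theorem rtr_self_mul_XiU (hσ : σ.PosSemidef) (hρ : ρ.IsHermitian) (h : msupp ρ ≤ msupp σ) :
    rtr (σ * XiU ρ σ) = rtr ρ := by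
  rw [rtr, rtr, trace_mul_XiU hσ hρ h, inEigenbasis_self, ← trace_inEigenbasis hσ.1 ρ,
    Matrix.trace]
  congr 1
  refine Finset.sum_congr rfl fun i _ => ?_
  rw [Finset.sum_eq_single i (fun j _ hj => by simp [Matrix.diagonal_apply_ne _ hj.symm])
    (by simp), Matrix.diagonal_apply_eq, Matrix.diag_apply]
  by_cases hi : hσ.1.eigenvalues i = 0
  · simp [inEigenbasis_apply_eq_zero_left hσ.1 h hi i]
  have hi' := lt_of_le_of_ne (hσ.eigenvalues_nonneg i) (Ne.symm hi)
  have hc : (hσ.1.eigenvalues i : ℂ) ≠ 0 := by exact_mod_cast hi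
  rw [integral_inv_add_sq hi']
  push_cast
  field_simp

theorem integrableOn_and_integral_resolvent_sub (hσ : σ.PosSemidef) (h : msupp ρ ≤ msupp σ) :
    IntegrableOn (fun s => rtr (ρ * resolvent σ s) - rtr ρ * (1 + s)⁻¹) (Ioi 0) ∧
    ∫ s in Ioi (0 : ℝ), (rtr (ρ * resolvent σ s) - rtr ρ * (1 + s)⁻¹) = -rtr (ρ * mlog σ) := by
  have hf : EqOn (fun s => ∑ i, (inEigenbasis hσ.1 ρ i i).re *
        ((hσ.1.eigenvalues i + s)⁻¹ - (1 + s)⁻¹))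
      (fun s => rtr (ρ * resolvent σ s) - rtr ρ * (1 + s)⁻¹) (Ioi 0) := by
    intro s hs
    simp only [resolvent, rtr]
    rw [inv_add_smul_one_eq_spectralFun hσ hs, trace_mul_spectralFun,
      ← trace_inEigenbasis hσ.1 ρ, Matrix.trace, Complex.re_sum, Complex.re_sum, Finset.sum_mul,
      ← Finset.sum_sub_distrib]
    refine Finset.sum_congr rfl fun i _ => ?_
    rw [Complex.re_mul_ofReal, Matrix.diag_apply, mul_sub]
  have hterm : ∀ i : ι,
      IntegrableOn (fun s : ℝ => (inEigenbasis hσ.1 ρ i i).re *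
        ((hσ.1.eigenvalues i + s)⁻¹ - (1 + s)⁻¹)) (Ioi 0) := by
    intro i
    by_cases hi : hσ.1.eigenvalues i = 0
    · simp [inEigenbasis_apply_eq_zero_left hσ.1 h hi i]
    have hi' := lt_of_le_of_ne (hσ.eigenvalues_nonneg i) (Ne.symm hi)
    exact (integrableOn_inv_add_sub_inv_add hi' one_pos).const_mul _
  refine ⟨IntegrableOn.congr_fun (integrable_finsetSum _ fun i _ => hterm i) hf
    measurableSet_Ioi, ?_⟩
  rw [← setIntegral_congr_fun measurableSet_Ioi hf, mlog_eq_spectralFun hσ.1, rtr,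
    trace_mul_spectralFun, integral_finsetSum _ fun i _ => hterm i, Complex.re_sum,
    ← Finset.sum_neg_distrib]
  refine Finset.sum_congr rfl fun i _ => ?_
  rw [Complex.re_mul_ofReal, integral_const_mul]
  by_cases hi : hσ.1.eigenvalues i = 0
  · simp [inEigenbasis_apply_eq_zero_left hσ.1 h hi i]
  have hi' := lt_of_le_of_ne (hσ.eigenvalues_nonneg i) (Ne.symm hi)
  rw [integral_inv_add_sub_inv_add hi' one_pos, Real.log_one]
  ring

/-! ### The tangent inequality for the logarithm -/

theorem rtr_sub {κ : Type*} [Fintype κ] (B C : Matrix κ κ ℂ) : rtr (B - C) = rtr B - rtr C := by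
  simp [rtr]

theorem rtr_add {κ : Type*} [Fintype κ] (B C : Matrix κ κ ℂ) : rtr (B + C) = rtr B + rtr C := by
  simp [rtr]

theorem rtr_smul {κ : Type*} [Fintype κ] (r : ℝ) (B : Matrix κ κ ℂ) :
    rtr (r • B) = r * rtr B := by simp [rtr]

theorem posDef_add_smul_one {κ : Type*} [DecidableEq κ] {A : Matrix κ κ ℂ} (hA : A.PosSemidef)
    {s : ℝ} (hs : 0 < s) :
    (A + (s : ℂ) • (1 : Matrix κ κ ℂ)).PosDef := by
  refine Matrix.PosDef.posSemidef_add hA (Matrix.PosDef.one.smul ?_)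
  exact_mod_cast hs

theorem resolvent_posDef (hσ : σ.PosSemidef) {s : ℝ} (hs : 0 < s) : (resolvent σ s).PosDef :=
  (posDef_add_smul_one hσ hs).inv

theorem rtr_mul_inv_sub_inv_le {A B : Matrix ι ι ℂ} (hρ : ρ.PosSemidef) (hA : A.PosDef)
    (hB : B.PosDef) :
    rtr (ρ * B⁻¹) - rtr (ρ * A⁻¹) ≤ rtr ((A - B) * (B⁻¹ * ρ * B⁻¹)) := by
  have hA' : IsUnit A.det := (Matrix.isUnit_iff_isUnit_det _).1 hA.isUnit
  have hB' : IsUnit B.det := (Matrix.isUnit_iff_isUnit_det _).1 hB.isUnit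
  have hD : (A⁻¹ - B⁻¹).conjTranspose = A⁻¹ - B⁻¹ := (hA.inv.1.sub hB.inv.1).eq
  have h1 := hA.posSemidef.conjTranspose_mul_mul_same (A⁻¹ - B⁻¹)
  rw [hD] at h1
  have h2 : (A⁻¹ - B⁻¹) * A * (A⁻¹ - B⁻¹) = B⁻¹ * (A - B) * B⁻¹ - (B⁻¹ - A⁻¹) := by
    simp only [Matrix.sub_mul, Matrix.mul_sub, Matrix.nonsing_inv_mul _ hA', Matrix.one_mul,
      Matrix.mul_assoc, Matrix.mul_nonsing_inv _ hA', Matrix.mul_one,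
      Matrix.mul_nonsing_inv _ hB']
    abel
  have h3 := rtr_mul_nonneg hρ h1
  rw [h2, Matrix.mul_sub, rtr_sub, Matrix.mul_sub ρ, rtr_sub] at h3
  have h4 : rtr (ρ * (B⁻¹ * (A - B) * B⁻¹)) = rtr ((A - B) * (B⁻¹ * ρ * B⁻¹)) := by
    rw [rtr, rtr, Matrix.trace_mul_comm ρ, Matrix.trace_mul_comm (A - B)]
    congr 1
    rw [Matrix.mul_assoc, Matrix.mul_assoc, Matrix.trace_mul_comm]
    simp only [Matrix.mul_assoc]
    rw [Matrix.trace_mul_comm]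
    simp only [Matrix.mul_assoc]
  linarith

theorem rtr_mul_mlog_sub_le {τ : Matrix ι ι ℂ} (hρ : ρ.PosSemidef) (hσ : σ.PosSemidef)
    (hτ : τ.PosSemidef) (hρσ : msupp ρ ≤ msupp σ) (hρτ : msupp ρ ≤ msupp τ) :
    rtr (ρ * mlog τ) - rtr (ρ * mlog σ) ≤ rtr (τ * XiU ρ σ) - rtr ρ := by
  obtain ⟨i1, e1⟩ := integrableOn_and_integral_resolvent_sub hσ hρσ
  obtain ⟨i2, e2⟩ := integrableOn_and_integral_resolvent_sub hτ hρτ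
  rw [← rtr_self_mul_XiU hσ hρ.1 hρσ, ← rtr_sub (τ * XiU ρ σ), ← Matrix.sub_mul,
    ← integral_rtr_resolvent hσ hρ.1 hρσ]
  have h : rtr (ρ * mlog τ) - rtr (ρ * mlog σ) = ∫ s in Ioi (0 : ℝ),
      ((rtr (ρ * resolvent σ s) - rtr ρ * (1 + s)⁻¹) -
        (rtr (ρ * resolvent τ s) - rtr ρ * (1 + s)⁻¹)) := by
    rw [integral_sub i1 i2, e1, e2]; ring
  rw [h]
  refine setIntegral_mono_on (i1.sub i2) (integrableOn_rtr_resolvent hσ hρ.1 hρσ _)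
    measurableSet_Ioi fun s hs => ?_
  have := rtr_mul_inv_sub_inv_le hρ (posDef_add_smul_one hτ hs) (posDef_add_smul_one hσ hs)
  rw [add_sub_add_right_eq_sub] at this
  simp only [resolvent]
  linarith

/-! ### Semicontinuity -/

theorem tendsto_resolvent {s : ℝ} (hs : 0 < s) (hσ : σ.PosSemidef) {u : ℕ → Matrix ι ι ℂ}
    (hu : Tendsto u atTop (nhds σ)) :
    Tendsto (fun n => resolvent (u n) s) atTop (nhds (resolvent σ s)) := by
  have hdet : (σ + (s : ℂ) • (1 : Matrix ι ι ℂ)).det ≠ 0 :=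
    ((Matrix.isUnit_iff_isUnit_det _).1 (posDef_add_smul_one hσ hs).isUnit).ne_zero
  have h1 : Tendsto (fun n => u n + (s : ℂ) • (1 : Matrix ι ι ℂ)) atTop
      (nhds (σ + (s : ℂ) • (1 : Matrix ι ι ℂ))) := hu.add_const _
  simp only [resolvent, Matrix.inv_def, Ring.inverse_eq_inv']
  refine Tendsto.smul ?_ ?_
  · exact Tendsto.inv₀ ((continuous_id.matrix_det.tendsto _).comp h1) hdet
  · exact ((continuous_id.matrix_adjugate.tendsto _).comp h1)

theorem rtr_mul_resolvent_nonneg {X : Matrix ι ι ℂ} (hX : X.PosSemidef) (hρ : ρ.PosSemidef)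
    (hσ : σ.PosSemidef) {s : ℝ} (hs : 0 < s) :
    0 ≤ rtr (X * (resolvent σ s * ρ * resolvent σ s)) := by
  refine rtr_mul_nonneg hX ?_
  have h := hρ.conjTranspose_mul_mul_same (resolvent σ s)
  rwa [(resolvent_posDef hσ hs).1.eq] at h

theorem rtr_mul_XiU_le_of_tendsto {X : Matrix ι ι ℂ} {u : ℕ → Matrix ι ι ℂ} {c : ℝ}
    (hX : X.PosSemidef) (hρ : ρ.PosSemidef) (hσ : σ.PosSemidef) (hu : ∀ n, (u n).PosSemidef)
    (hρσ : msupp ρ ≤ msupp σ) (hρu : ∀ n, msupp ρ ≤ msupp (u n))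
    (hlim : Tendsto u atTop (nhds σ)) (hc : ∀ n, rtr (X * XiU ρ (u n)) ≤ c) :
    rtr (X * XiU ρ σ) ≤ c := by
  have hint : ∀ {A : Matrix ι ι ℂ}, A.PosSemidef → msupp ρ ≤ msupp A →
      ∫⁻ s in Ioi (0 : ℝ), ENNReal.ofReal (rtr (X * (resolvent A s * ρ * resolvent A s))) =
        ENNReal.ofReal (rtr (X * XiU ρ A)) := by
    intro A hA hρA
    rw [← integral_rtr_resolvent hA hρ.1 hρA, ofReal_integral_eq_lintegral_ofReal
      (integrableOn_rtr_resolvent hA hρ.1 hρA X)]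
    exact (ae_restrict_mem measurableSet_Ioi).mono fun s hs =>
      rtr_mul_resolvent_nonneg hX hρ hA hs
  have hc0 : 0 ≤ c := by
    refine le_trans ?_ (hc 0)
    rw [← integral_rtr_resolvent (hu 0) hρ.1 (hρu 0)]
    exact setIntegral_nonneg measurableSet_Ioi fun s hs =>
      rtr_mul_resolvent_nonneg hX hρ (hu 0) hs
  rw [← ENNReal.ofReal_le_ofReal_iff hc0, ← hint hσ hρσ]
  have hpt : ∀ s ∈ Ioi (0 : ℝ),
      ENNReal.ofReal (rtr (X * (resolvent σ s * ρ * resolvent σ s))) =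
      liminf (fun n => ENNReal.ofReal
        (rtr (X * (resolvent (u n) s * ρ * resolvent (u n) s)))) atTop := by
    intro s hs
    have h1 := tendsto_resolvent hs hσ hlim
    have h2 : Tendsto (fun n => X * (resolvent (u n) s * ρ * resolvent (u n) s)) atTop
        (nhds (X * (resolvent σ s * ρ * resolvent σ s))) :=
      tendsto_const_nhds.mul ((h1.mul tendsto_const_nhds).mul h1)
    have h3 : Continuous (fun M : Matrix ι ι ℂ => ENNReal.ofReal (rtr M)) :=
      ENNReal.continuous_ofReal.comp (Complex.continuous_re.comp continuous_id.matrix_trace)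
    exact ((h3.tendsto _).comp h2).liminf_eq.symm
  rw [setLIntegral_congr_fun measurableSet_Ioi hpt]
  refine (lintegral_liminf_le' fun n => ?_).trans ?_
  · have hi := integrableOn_rtr_resolvent (hu n) hρ.1 (hρu n) X
    exact hi.aestronglyMeasurable.aemeasurable.ennreal_ofReal
  · refine liminf_le_of_frequently_le' (Frequently.of_forall fun n => ?_)
    rw [hint (hu n) (hρu n)]
    exact ENNReal.ofReal_le_ofReal (hc n)

end Representation

/-! ### Minimizers -/

theorem msupp_le_msupp_smul {ι : Type*} [Fintype ι] [DecidableEq ι] (A : Matrix ι ι ℂ) {r : ℝ}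
    (hr : r ≠ 0) : msupp A ≤ msupp (r • A) := by
  rw [msupp_le_iff_exists_mul]
  refine ⟨r⁻¹ • 1, ?_⟩
  rw [Matrix.smul_mul, Matrix.mul_smul, Matrix.mul_one, smul_smul, mul_inv_cancel₀ hr, one_smul]

theorem relEnt_le_relEnt_iff {ι : Type*} [Fintype ι] [DecidableEq ι] {ρ σ τ : Matrix ι ι ℂ}
    (hσ : msupp ρ ≤ msupp σ) (hτ : msupp ρ ≤ msupp τ) :
    relEnt ρ σ ≤ relEnt ρ τ ↔ rtr (ρ * mlog τ) ≤ rtr (ρ * mlog σ) := by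
  rw [relEnt, relEnt, if_pos hσ, if_pos hτ, EReal.coe_le_coe_iff, Matrix.mul_sub, Matrix.mul_sub,
    rtr_sub, rtr_sub, sub_le_sub_iff_left]

/-- First-order optimality: along the segment from a minimizer `σ₀` to `τ`, the pairing of `τ`
with `Ξ` is at most one. -/
theorem rtr_mul_XiU_le_one_of_isMin {ι : Type*} [Fintype ι] [DecidableEq ι]
    {ρ σ₀ τ : Matrix ι ι ℂ} (hρ : IsState ρ) (hσ₀ : σ₀.PosSemidef) (hτ : τ.PosSemidef)
    (h : msupp ρ ≤ msupp σ₀)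
    (hmin : ∀ r ∈ Ioo (0 : ℝ) 1, relEnt ρ σ₀ ≤ relEnt ρ ((1 - r) • σ₀ + r • τ)) :
    rtr (τ * XiU ρ σ₀) ≤ 1 := by
  have hρ1 : rtr ρ = 1 := by simp [rtr, hρ.2]
  have hpsd : ∀ r ∈ Ioo (0 : ℝ) 1, ((1 - r) • σ₀ + r • τ).PosSemidef := fun r hr =>
    (hσ₀.smul (sub_nonneg.2 hr.2.le)).add (hτ.smul hr.1.le)
  have hs : ∀ r ∈ Ioo (0 : ℝ) 1, msupp ρ ≤ msupp ((1 - r) • σ₀ + r • τ) := fun r hr =>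
    h.trans ((msupp_le_msupp_smul σ₀ (sub_pos.2 hr.2).ne').trans
      (msupp_le_msupp_add (hσ₀.smul (sub_nonneg.2 hr.2.le)) (hτ.smul hr.1.le)))
  have hle : ∀ r ∈ Ioo (0 : ℝ) 1, rtr (τ * XiU ρ ((1 - r) • σ₀ + r • τ)) ≤ 1 := by
    intro r hr
    have h1 := (relEnt_le_relEnt_iff h (hs r hr)).1 (hmin r hr)
    have h2 := rtr_mul_mlog_sub_le hρ.1 (hpsd r hr) hσ₀ (hs r hr) h
    have h3 := rtr_self_mul_XiU (hpsd r hr) hρ.1.1 (hs r hr)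
    rw [Matrix.add_mul, Matrix.smul_mul, Matrix.smul_mul, rtr_add, rtr_smul, rtr_smul] at h3
    nlinarith [hr.1, hr.2]
  have hr : ∀ n : ℕ, ((n : ℝ) + 1 + 1)⁻¹ ∈ Ioo (0 : ℝ) 1 := fun n =>
    ⟨by positivity, inv_lt_one_of_one_lt₀ (by have := n.cast_nonneg (α := ℝ); linarith)⟩
  have hlim : Tendsto (fun n : ℕ => ((n : ℝ) + 1 + 1)⁻¹) atTop (nhds 0) :=
    tendsto_inv_atTop_zero.comp
      (tendsto_atTop_add_const_right _ _
        (tendsto_atTop_add_const_right _ _ tendsto_natCast_atTop_atTop))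
  refine rtr_mul_XiU_le_of_tendsto hτ hρ.1 hσ₀ (fun n => hpsd _ (hr n)) h
    (fun n => hs _ (hr n)) ?_ (fun n => hle _ (hr n))
  have hc : Continuous fun r : ℝ => (1 - r) • σ₀ + r • τ := by fun_prop
  simpa [Function.comp_def] using (hc.tendsto 0).comp hlim

/-- Lemma 2 of the paper: necessary and sufficient condition for a
minimizer of the Umegaki relative entropy over a convex compact set of positive
semidefinite operators. -/
theorem umegaki_minimizer_iff {d : ℕ}
    (ρ : Matrix (Fin d) (Fin d) ℂ) (hρ : IsState ρ)
    (S : Set (Matrix (Fin d) (Fin d) ℂ))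
    (hconv : Convex ℝ S) (hcomp : IsCompact S)
    (hpsd : ∀ X ∈ S, X.PosSemidef)
    (hsupp : ∃ τ ∈ S, IsState τ ∧ msupp ρ ≤ msupp τ)
    (σ₀ : Matrix (Fin d) (Fin d) ℂ) (hσ₀ : σ₀ ∈ S) :
    (∀ σ ∈ S, relEnt ρ σ₀ ≤ relEnt ρ σ) ↔
      (msupp ρ ≤ msupp σ₀ ∧
        (⨆ τ ∈ S, ((rtr (τ * XiU ρ σ₀) : ℝ) : EReal)) = 1) := by
  have hρ1 : rtr ρ = 1 := by simp [rtr, hρ.2]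
  constructor
  · intro hmin
    have h : msupp ρ ≤ msupp σ₀ := by
      obtain ⟨τ, hτS, -, hτ⟩ := hsupp
      by_contra hn
      have := hmin τ hτS
      rw [relEnt, relEnt, if_neg hn, if_pos hτ] at this
      exact absurd this (not_le.2 (EReal.coe_lt_top _))
    refine ⟨h, le_antisymm (iSup₂_le fun τ hτ => ?_) ?_⟩
    · exact_mod_cast rtr_mul_XiU_le_one_of_isMin hρ (hpsd _ hσ₀) (hpsd _ hτ) h fun r hr =>
        hmin _ (hconv hσ₀ hτ (sub_nonneg.2 hr.2.le) hr.1.le (sub_add_cancel _ _))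
    · refine le_trans (le_of_eq ?_) (le_iSup₂ σ₀ hσ₀)
      rw [rtr_self_mul_XiU (hpsd _ hσ₀) hρ.1.1 h, hρ1, EReal.coe_one]
  · rintro ⟨h, hsup⟩ τ hτ
    by_cases hτs : msupp ρ ≤ msupp τ
    · have h1 : rtr (τ * XiU ρ σ₀) ≤ 1 := by
        have := (le_iSup₂ (f := fun τ (_ : τ ∈ S) => ((rtr (τ * XiU ρ σ₀) : ℝ) : EReal))
          τ hτ).trans hsup.le
        exact_mod_cast this
      rw [relEnt_le_relEnt_iff h hτs]
      have h2 := rtr_mul_mlog_sub_le hρ.1 (hpsd _ hσ₀) (hpsd _ hτ) h hτs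
      linarith
    · rw [relEnt.eq_1 ρ τ, if_neg hτs]
      exact le_top

end QHT
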